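/- Let a, b, c ∈ ℝ with a ≤ 0 and c > b > 0. Then for every z ∈ [0,1] the series ∑_{j=0}^∞ ((a)_j (b)_j / ((c)_j · j!)) z^j is summable, and the function z ↦ F(a,b;c;z) defined by this sum is antitone (monotonically nonincreasing) on the interval [0,1]. -/

import Mathlib

/-- The rising factorial (Pochhammer symbol) `(x)_j = x(x+1)⋯(x+j-1)`. -/
noncomputable def risingFactorial (j : ℕ) (x : ℝ) : ℝ := (ascPochhammer ℝ j).eval x

/-- The Gauss hypergeometric function `F(a,b;c;z) = ∑_{j=0}^∞ ((a)_j (b)_j/((c)_j j!)) z^j`. -/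
noncomputable def hypF (a b c z : ℝ) : ℝ :=
  ∑' j : ℕ, risingFactorial j a * risingFactorial j b
    / (risingFactorial j c * (Nat.factorial j : ℝ)) * z ^ j

open MeasureTheory ProbabilityTheory Set

lemma risingFactorial_zero (x : ℝ) : risingFactorial 0 x = 1 := by
  simp [risingFactorial]

lemma risingFactorial_succ (j : ℕ) (x : ℝ) :
    risingFactorial (j + 1) x = risingFactorial j x * (x + j) :=
  ascPochhammer_succ_eval j x

lemma risingFactorial_pos (j : ℕ) {x : ℝ} (hx : 0 < x) : 0 < risingFactorial j x :=
  ascPochhammer_pos j x hx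

lemma Gamma_add_nat_eq_risingFactorial_mul (j : ℕ) {x : ℝ} (hx : 0 < x) :
    Real.Gamma (x + j) = risingFactorial j x * Real.Gamma x := by
  induction j with
  | zero => simp [risingFactorial_zero]
  | succ j ih =>
    rw [Nat.cast_succ, ← add_assoc, Real.Gamma_add_one (by positivity), ih, risingFactorial_succ]
    ring

lemma beta_add_nat_left (j : ℕ) {b d : ℝ} (hb : 0 < b) (hd : 0 < d) :
    beta (b + j) d = risingFactorial j b / risingFactorial j (b + d) * beta b d := by
  have h : b + j + d = b + d + j := by ring
  rw [beta, beta, h, Gamma_add_nat_eq_risingFactorial_mul j hb,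
    Gamma_add_nat_eq_risingFactorial_mul j (add_pos hb hd), mul_assoc, mul_div_mul_comm]

lemma integral_betaPDFReal {b d : ℝ} (hb : 0 < b) (hd : 0 < d) :
    ∫ x, betaPDFReal b d x = 1 := by
  rw [integral_eq_lintegral_of_nonneg_ae _ (by fun_prop)]
  · exact (congrArg ENNReal.toReal (lintegral_betaPDF_eq_one hb hd)).trans ENNReal.toReal_one
  · refine ae_of_all _ fun x => ?_
    by_cases hx : 0 < x ∧ x < 1
    · exact (betaPDFReal_pos hx.1 hx.2 hb hd).le
    · simp [betaPDFReal, hx]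

lemma ae_betaMeasure_mem_Ioo (b d : ℝ) : ∀ᵐ x ∂betaMeasure b d, x ∈ Ioo (0 : ℝ) 1 := by
  rw [betaMeasure, ae_withDensity_iff (f := betaPDF b d) (measurable_betaPDFReal b d).ennreal_ofReal]
  refine ae_of_all _ fun x hx => ?_
  contrapose! hx
  have hx' : ¬ (0 < x ∧ x < 1) := hx
  simp [betaPDF_eq, hx']

/-- The moments of the beta distribution. -/
lemma integral_pow_betaMeasure (j : ℕ) {b d : ℝ} (hb : 0 < b) (hd : 0 < d) :
    ∫ x, x ^ j ∂betaMeasure b d = risingFactorial j b / risingFactorial j (b + d) := by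
  have hB := (beta_pos hb hd).ne'
  have hBj := (beta_pos (add_pos_of_pos_of_nonneg hb (Nat.cast_nonneg j)) hd).ne'
  have hpdf : ∀ x, (betaPDF b d x).toReal • x ^ j =
      beta (b + j) d / beta b d * betaPDFReal (b + j) d x := by
    intro x
    by_cases hx : 0 < x ∧ x < 1
    · have hpow : x ^ (b + j - 1) = x ^ (b - 1) * x ^ j := by
        rw [← Real.rpow_add_natCast hx.1.ne']
        ring_nf
      rw [betaPDF, ENNReal.toReal_ofReal (betaPDFReal_pos hx.1 hx.2 hb hd).le, betaPDFReal,
        betaPDFReal, if_pos hx, if_pos hx, hpow, smul_eq_mul]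
      field_simp
    · simp [betaPDF, betaPDFReal, hx]
  rw [betaMeasure, integral_withDensity_eq_integral_toReal_smul (f := betaPDF b d)
    (measurable_betaPDFReal b d).ennreal_ofReal (ae_of_all _ fun x => ENNReal.ofReal_lt_top)]
  simp_rw [hpdf]
  rw [integral_const_mul, integral_betaPDFReal (by positivity) hd, mul_one,
    beta_add_nat_left j hb hd, mul_div_assoc, div_self hB, mul_one]

/-- The binomial series of `(1 - x) ^ (-a)` converges absolutely at `x = 1` when `a ≤ 0`. -/
lemma summable_abs_risingFactorial_div_factorial {a : ℝ} (ha : a ≤ 0) :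
    Summable fun j : ℕ => |risingFactorial j a / (j.factorial : ℝ)| := by
  set v : ℕ → ℝ := fun j => |risingFactorial j a / (j.factorial : ℝ)| with hv
  obtain ⟨N, hN⟩ := exists_nat_ge (-a)
  have hstep : ∀ j ≥ N, ((j : ℝ) + 1) * v (j + 1) = (a + j) * v j := by
    intro j hj
    have hj' : 0 ≤ a + j := by
      have : (N : ℝ) ≤ j := by exact_mod_cast hj
      linarith
    have hj1 : (0 : ℝ) < j + 1 := by positivity
    have h : risingFactorial (j + 1) a / ((j + 1).factorial : ℝ) =
        (a + j) / (j + 1) * (risingFactorial j a / (j.factorial : ℝ)) := by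
      rw [risingFactorial_succ, Nat.factorial_succ]
      push_cast
      field_simp
    simp only [hv]
    rw [h, abs_mul, abs_of_nonneg (div_nonneg hj' hj1.le)]
    field_simp
  rcases ha.eq_or_lt with rfl | ha
  · refine summable_of_ne_finset_zero (s := {0}) fun j hj => ?_
    obtain ⟨k, rfl⟩ := Nat.exists_eq_succ_of_ne_zero (by simpa using hj)
    simp [hv, risingFactorial, ascPochhammer_ne_zero_eval_zero]
  · have htel : ∀ n : ℕ, (-a) * ∑ i ∈ Finset.range n, v (i + N) =
        N * v N - (n + N : ℕ) * v (n + N) := by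
      intro n
      induction n with
      | zero => simp
      | succ n ih =>
        have h := hstep (n + N) (Nat.le_add_left N n)
        rw [Finset.sum_range_succ, mul_add, ih, add_right_comm n 1 N]
        push_cast at h ⊢
        linarith
    refine (summable_nat_add_iff N).1 (summable_of_sum_range_le (c := N * v N / (-a))
      (fun i => abs_nonneg _) fun n => ?_)
    rw [le_div_iff₀ (neg_pos.2 ha), mul_comm, htel]
    exact sub_le_self _ (mul_nonneg (Nat.cast_nonneg _) (abs_nonneg _))

lemma hasSum_risingFactorial_div_factorial_mul_pow (a : ℝ) {x : ℝ} (hx : |x| < 1) :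
    HasSum (fun j : ℕ => risingFactorial j a / (j.factorial : ℝ) * x ^ j) ((1 - x) ^ (-a)) := by
  have hmem : x ∈ Metric.eball (0 : ℝ) 1 := by
    rw [Metric.mem_eball, edist_zero_right, ← ofReal_norm]
    simpa using hx
  have h := (Real.one_div_one_sub_rpow_hasFPowerSeriesOnBall_zero a).hasSum hmem
  have hx1 : 0 ≤ 1 - x := by linarith [le_abs_self x]
  rw [zero_add, one_div, ← Real.rpow_neg hx1] at h
  convert! h using 2 with j
  have hc := Ring.factorial_nsmul_multichoose_eq_ascPochhammer a j
  rw [Polynomial.ascPochhammer_smeval_eq_eval, Ring.multichoose_eq, nsmul_eq_mul] at hc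
  rw [FormalMultilinearSeries.ofScalars_apply_eq, risingFactorial, ← hc,
    mul_div_cancel_left₀ _ (by positivity), smul_eq_mul]

lemma risingFactorial_div_le_one (j : ℕ) {b c : ℝ} (hb : 0 < b) (hbc : b ≤ c) :
    risingFactorial j b / risingFactorial j c ≤ 1 := by
  rw [div_le_one (risingFactorial_pos j (hb.trans_le hbc))]
  induction j with
  | zero => simp [risingFactorial_zero]
  | succ j ih =>
    rw [risingFactorial_succ, risingFactorial_succ]
    have := risingFactorial_pos j (hb.trans_le hbc)
    gcongr

/-- Euler's integral representation, against the beta distribution. -/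
lemma hasSum_hypergeometric {a b c z : ℝ} (ha : a ≤ 0) (hb : 0 < b) (hbc : b < c)
    (hz : z ∈ Icc (0 : ℝ) 1) :
    HasSum (fun j : ℕ => risingFactorial j a * risingFactorial j b
        / (risingFactorial j c * (j.factorial : ℝ)) * z ^ j)
      (∫ t, (1 - z * t) ^ (-a) ∂betaMeasure b (c - b)) := by
  have hd : 0 < c - b := sub_pos.2 hbc
  have := isProbabilityMeasureBeta hb hd
  have hsupp := ae_betaMeasure_mem_Ioo b (c - b)
  have hmoment : ∀ j, ∫ t, t ^ j ∂betaMeasure b (c - b) =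
      risingFactorial j b / risingFactorial j c := fun j => by
    rw [integral_pow_betaMeasure j hb hd, add_sub_cancel]
  have hpow_int : ∀ j : ℕ, Integrable (fun t : ℝ => t ^ j) (betaMeasure b (c - b)) := fun j =>
    .of_bound (by fun_prop) 1 <| hsupp.mono fun t ht => by
      rw [Real.norm_of_nonneg (pow_nonneg ht.1.le j)]
      exact pow_le_one₀ ht.1.le ht.2.le
  have h := hasSum_integral_of_summable_integral_norm (μ := betaMeasure b (c - b))
    (F := fun (j : ℕ) t => risingFactorial j a / (j.factorial : ℝ) * z ^ j * t ^ j)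
    (fun j => (hpow_int j).const_mul _) ?_
  · convert! h using 1
    · ext j
      rw [integral_const_mul, hmoment]
      ring
    · refine integral_congr_ae (hsupp.mono fun t ht => ?_)
      have hzt : |z * t| < 1 := by
        rw [abs_of_nonneg (mul_nonneg hz.1 ht.1.le)]
        exact (mul_le_of_le_one_left ht.1.le hz.2).trans_lt ht.2
      simpa only [mul_pow, mul_assoc] using
        (hasSum_risingFactorial_div_factorial_mul_pow a hzt).tsum_eq.symm
  · refine (summable_abs_risingFactorial_div_factorial ha).of_nonneg_of_le
      (fun j => integral_nonneg fun t => norm_nonneg _) fun j => ?_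
    have hnorm : ∫ t, ‖risingFactorial j a / (j.factorial : ℝ) * z ^ j * t ^ j‖
        ∂betaMeasure b (c - b) = |risingFactorial j a / (j.factorial : ℝ)| * z ^ j *
          (risingFactorial j b / risingFactorial j c) := by
      rw [← hmoment, ← integral_const_mul]
      refine integral_congr_ae (hsupp.mono fun t ht => ?_)
      simp only [Real.norm_eq_abs, abs_mul, abs_pow, abs_of_nonneg hz.1, abs_of_pos ht.1]
    rw [hnorm, mul_assoc]
    refine mul_le_of_le_one_right (abs_nonneg _) (mul_le_one₀ (pow_le_one₀ hz.1 hz.2) ?_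
      (risingFactorial_div_le_one j hb hbc.le))
    exact (div_pos (risingFactorial_pos j hb) (risingFactorial_pos j (hb.trans hbc))).le

lemma integrable_one_sub_mul_rpow_betaMeasure {b d s z : ℝ} (hb : 0 < b) (hd : 0 < d)
    (hs : 0 ≤ s) (hz : z ∈ Icc (0 : ℝ) 1) :
    Integrable (fun t => (1 - z * t) ^ s) (betaMeasure b d) := by
  have := isProbabilityMeasureBeta hb hd
  refine .of_bound (Measurable.aestronglyMeasurable (by fun_prop)) 1
    ((ae_betaMeasure_mem_Ioo b d).mono fun t ht => ?_)
  have h0 : 0 ≤ z * t := mul_nonneg hz.1 ht.1.le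
  have h1 : z * t ≤ 1 := mul_le_one₀ hz.2 ht.1.le ht.2.le
  rw [Real.norm_of_nonneg (Real.rpow_nonneg (by linarith) s)]
  exact Real.rpow_le_one (by linarith) (by linarith) hs

/-- For `a ≤ 0` and `c > b > 0`, the hypergeometric series is summable at
every `z ∈ [0,1]`, and `z ↦ F(a,b;c;z)` is antitone on `[0,1]`. -/
theorem hypergeometric_antitone
    (a b c : ℝ) (ha : a ≤ 0) (hb : 0 < b) (hcb : b < c) :
    (∀ z ∈ Set.Icc (0:ℝ) 1,
      Summable (fun j : ℕ => risingFactorial j a * risingFactorial j b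
        / (risingFactorial j c * (Nat.factorial j : ℝ)) * z ^ j)) ∧
    AntitoneOn (fun z => hypF a b c z) (Set.Icc (0:ℝ) 1) := by
  refine ⟨fun z hz => (hasSum_hypergeometric ha hb hcb hz).summable, fun z hz w hw hzw => ?_⟩
  have hs : 0 ≤ -a := neg_nonneg.2 ha
  have hd : 0 < c - b := sub_pos.2 hcb
  simp only [hypF]
  rw [(hasSum_hypergeometric ha hb hcb hz).tsum_eq, (hasSum_hypergeometric ha hb hcb hw).tsum_eq]
  refine integral_mono_ae (integrable_one_sub_mul_rpow_betaMeasure hb hd hs hw)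
    (integrable_one_sub_mul_rpow_betaMeasure hb hd hs hz)
    ((ae_betaMeasure_mem_Ioo b (c - b)).mono fun t ht => ?_)
  have h1 : w * t ≤ 1 := mul_le_one₀ hw.2 ht.1.le ht.2.le
  have h2 : z * t ≤ w * t := mul_le_mul_of_nonneg_right hzw ht.1.le
  exact Real.rpow_le_rpow (by linarith) (by linarith) hs
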